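/- Let A : ℤ³ → ℂ satisfy A(n,r,m) = 0 unless n > 0 and 4nm > r², and suppose the series F(τ,z,τ') = Σ_{n,r,m∈ℤ} A(n,r,m)·e(nτ+rz+mτ') converges absolutely at every point of ℍ₂. Define F↑(τ,z,τ') = F(2τ,2z,τ')·F(τ/2,z,τ')·F((τ+1)/2,z,τ'). Suppose B : ℤ³ → ℂ is such that F↑(τ,z,τ') = Σ_{n,r,m∈ℤ} B(n,r,m)·e(nτ+rz+mτ') with absolute convergence at every point of ℍ₂. Then for every r ∈ ℤ: B(4,r,3) = Σ_{r₁,r₂,r₃∈ℤ, 2r₁+r₂+r₃=r} A(1,r₁,1)·( A(2,r₂,1)·A(2,r₃,1) − A(3,r₂,1)·A(1,r₃,1) − A(1,r₂,1)·A(3,r₃,1) ) (a finite sum, by the support condition on A). -/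

import Mathlib

noncomputable section
open Complex BigOperators

namespace HeimMurase

/-- `e(u) = exp(2 π i u)`. -/
def e (u : ℂ) : ℂ := Complex.exp (2 * Real.pi * Complex.I * u)

/-- The Siegel upper half space of degree 2, in the coordinates `(τ, z, τ')` of a symmetric
`2×2` complex matrix `(τ z; z τ')`. -/
def H2 : Set (ℂ × ℂ × ℂ) :=
  {t | 0 < t.1.im ∧ 0 < t.2.2.im ∧ (t.2.1.im) ^ 2 < t.1.im * t.2.2.im}

/-- The Fourier series `F(τ,z,τ') = Σ_{n,r,m} A(n,r,m) e(nτ + rz + mτ')`. -/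
def FS (A : ℤ × ℤ × ℤ → ℂ) (τ z τ' : ℂ) : ℂ :=
  ∑' q : ℤ × ℤ × ℤ, A q * e ((q.1 : ℂ) * τ + (q.2.1 : ℂ) * z + (q.2.2 : ℂ) * τ')

theorem e_add (u v : ℂ) : e (u + v) = e u * e v := by
  simp only [e, mul_add, Complex.exp_add]

theorem e_ne_zero (u : ℂ) : e u ≠ 0 := Complex.exp_ne_zero _

theorem norm_e_ofReal (x : ℝ) : ‖e x‖ = 1 := by
  have h : (2 * Real.pi * Complex.I * x : ℂ) = ((2 * Real.pi * x : ℝ) : ℂ) * Complex.I := by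
    push_cast; ring
  rw [e, h, Complex.norm_exp_ofReal_mul_I]

theorem e_int (n : ℤ) : e n = 1 := by
  rw [e, mul_comm]
  exact Complex.exp_int_mul_two_pi_mul_I n

theorem continuous_e : Continuous e := by
  unfold e
  fun_prop

theorem integral_e_int_mul (k : ℤ) :
    ∫ x in (0 : ℝ)..1, e (k * x) = if k = 0 then 1 else 0 := by
  split_ifs with hk
  · simp [hk, e]
  · have hc : (2 * Real.pi * Complex.I * k : ℂ) ≠ 0 := by
      have : (k : ℂ) ≠ 0 := by exact_mod_cast hk
      simp [this, Real.pi_ne_zero]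
    have h1 : Complex.exp (2 * Real.pi * Complex.I * k) = 1 := e_int k
    have := integral_exp_mul_complex (a := 0) (b := 1) hc
    simp only [e, ← mul_assoc]
    rw [this]
    simp [h1]

theorem summable_ite {ι : Type*} {a : ι → ℂ} (ha : Summable a) (p : ι → Prop) [DecidablePred p] :
    Summable fun i => if p i then a i else 0 := by
  refine Summable.of_norm_bounded ha.norm fun i => ?_
  split_ifs <;> simp

/-- The Fourier coefficient of an absolutely convergent trigonometric series in one variable. -/
theorem tsum_fiber_eq_integral {ι : Type*} [Countable ι] {a : ι → ℂ} (ha : Summable a)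
    (f : ι → ℤ) (n : ℤ) :
    ∑' i, (if f i = n then a i else 0)
      = ∫ x in (0 : ℝ)..1, (∑' i, a i * e (f i * x)) * e (-(n * x)) := by
  have key : ∀ (i : ι) (x : ℝ),
      a i * e (f i * x) * e (-(n * x)) = a i * e (((f i - n : ℤ) : ℂ) * x) := by
    intro i x
    rw [mul_assoc, ← e_add]
    congr 2
    push_cast
    ring
  have hcont : ∀ i, Continuous fun x : ℝ => a i * e (((f i - n : ℤ) : ℂ) * x) := fun i =>
    continuous_const.mul (continuous_e.comp (by fun_prop))
  have hnorm : ∀ (i : ι) (x : ℝ), ‖a i * e (((f i - n : ℤ) : ℂ) * x)‖ = ‖a i‖ := by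
    intro i x
    have := norm_e_ofReal (((f i - n : ℤ) : ℝ) * x)
    push_cast at this ⊢
    rw [norm_mul, this, mul_one]
  have h := intervalIntegral.hasSum_integral_of_dominated_convergence
    (μ := MeasureTheory.volume) (a := (0 : ℝ)) (b := 1)
    (F := fun i (x : ℝ) => a i * e (((f i - n : ℤ) : ℂ) * x))
    (f := fun x : ℝ => ∑' i, a i * e (((f i - n : ℤ) : ℂ) * x))
    (fun i _ => ‖a i‖)
    (fun i => (hcont i).aestronglyMeasurable)
    (fun i => Filter.Eventually.of_forall fun x _ => (hnorm i x).le)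
    (Filter.Eventually.of_forall fun _ _ => ha.norm)
    (by simp)
    (Filter.Eventually.of_forall fun x _ =>
      (Summable.of_norm (by simpa only [hnorm] using ha.norm)).hasSum)
  simp only [← tsum_mul_right, key]
  rw [← h.tsum_eq]
  refine tsum_congr fun i => ?_
  rw [intervalIntegral.integral_const_mul, integral_e_int_mul]
  simp [sub_eq_zero]

/-- Uniqueness of Fourier coefficients in one variable, for series with repeated frequencies. -/
theorem tsum_fiber_congr {ι κ : Type*} [Countable ι] [Countable κ] {a : ι → ℂ} {b : κ → ℂ}
    (ha : Summable a) (hb : Summable b) (f : ι → ℤ) (g : κ → ℤ)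
    (h : ∀ x : ℝ, ∑' i, a i * e (f i * x) = ∑' k, b k * e (g k * x)) (n : ℤ) :
    ∑' i, (if f i = n then a i else 0) = ∑' k, (if g k = n then b k else 0) := by
  simp only [tsum_fiber_eq_integral ha, tsum_fiber_eq_integral hb, h]

theorem summable_mul_e {ι : Type*} {a : ι → ℂ} (ha : Summable a) (x : ι → ℝ) :
    Summable fun i => a i * e (x i) := by
  refine Summable.of_norm_bounded ha.norm fun i => ?_
  rw [norm_mul, norm_e_ofReal, mul_one]

/-- Uniqueness of Fourier coefficients in three variables, for series with repeated
frequencies. -/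
theorem tsum_fiber_congr₃ {ι κ : Type*} [Countable ι] [Countable κ] {a : ι → ℂ} {b : κ → ℂ}
    (ha : Summable a) (hb : Summable b) (f : ι → ℤ × ℤ × ℤ) (g : κ → ℤ × ℤ × ℤ)
    (h : ∀ x y z : ℝ,
      ∑' i, a i * e ((f i).1 * x + (f i).2.1 * y + (f i).2.2 * z)
        = ∑' k, b k * e ((g k).1 * x + (g k).2.1 * y + (g k).2.2 * z)) (n : ℤ × ℤ × ℤ) :
    ∑' i, (if f i = n then a i else 0) = ∑' k, (if g k = n then b k else 0) := by
  have h₁ : ∀ y z : ℝ,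
      ∑' i, (if (f i).1 = n.1 then a i else 0) * e ((f i).2.1 * y + (f i).2.2 * z)
        = ∑' k, (if (g k).1 = n.1 then b k else 0) * e ((g k).2.1 * y + (g k).2.2 * z) := by
    intro y z
    have hsa := summable_mul_e ha fun i => (f i).2.1 * y + (f i).2.2 * z
    have hsb := summable_mul_e hb fun k => (g k).2.1 * y + (g k).2.2 * z
    push_cast at hsa hsb
    have := tsum_fiber_congr hsa hsb (fun i => (f i).1) (fun k => (g k).1)
      (fun x => by
        convert h x y z using 3 with i k
        · rw [mul_assoc, ← e_add]
          congr 2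
          ring
        · rw [mul_assoc, ← e_add]
          congr 2
          ring) n.1
    simpa only [ite_mul, zero_mul] using this
  have h₂ : ∀ z : ℝ,
      ∑' i, (if (f i).2.1 = n.2.1 then if (f i).1 = n.1 then a i else 0 else 0)
            * e ((f i).2.2 * z)
        = ∑' k, (if (g k).2.1 = n.2.1 then if (g k).1 = n.1 then b k else 0 else 0)
            * e ((g k).2.2 * z) := by
    intro z
    have hsa := summable_mul_e (summable_ite ha fun i => (f i).1 = n.1) fun i => (f i).2.2 * z
    have hsb := summable_mul_e (summable_ite hb fun k => (g k).1 = n.1) fun k => (g k).2.2 * z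
    push_cast at hsa hsb
    have := tsum_fiber_congr hsa hsb (fun i => (f i).2.1) (fun k => (g k).2.1)
      (fun y => by
        convert h₁ y z using 3 with i k
        · rw [mul_assoc, ← e_add, add_comm]
        · rw [mul_assoc, ← e_add, add_comm]) n.2.1
    simpa only [ite_mul, zero_mul] using this
  have h₃ := tsum_fiber_congr
    (summable_ite (summable_ite ha fun i => (f i).1 = n.1) fun i => (f i).2.1 = n.2.1)
    (summable_ite (summable_ite hb fun k => (g k).1 = n.1) fun k => (g k).2.1 = n.2.1)
    (fun i => (f i).2.2) (fun k => (g k).2.2) h₂ n.2.2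
  convert h₃ using 3 with i k
  · simp only [Prod.ext_iff, ← ite_and]
    exact if_congr (by tauto) rfl rfl
  · simp only [Prod.ext_iff, ← ite_and]
    exact if_congr (by tauto) rfl rfl

theorem e_one_half : e (1 / 2) = -1 := by
  rw [e, ← Complex.exp_pi_mul_I]
  congr 1
  ring

theorem e_three_halves : e (3 / 2) = -1 := by
  have h : (3 / 2 : ℂ) = 1 / 2 + (1 : ℤ) := by norm_num
  rw [h, e_add, e_one_half, e_int, mul_one]

theorem summable_mul_mul {ι : Type*} {a b c : ι → ℂ} (ha : Summable a) (hb : Summable b)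
    (hc : Summable c) : Summable fun p : (ι × ι) × ι => a p.1.1 * b p.1.2 * c p.2 :=
  summable_mul_of_summable_norm (f := fun p : ι × ι => a p.1 * b p.2)
    (summable_mul_of_summable_norm ha.norm hb.norm).norm hc.norm

theorem tsum_mul_tsum_mul_tsum {ι : Type*} {a b c : ι → ℂ} (ha : Summable a) (hb : Summable b)
    (hc : Summable c) : (∑' i, a i) * (∑' i, b i) * (∑' i, c i)
      = ∑' p : (ι × ι) × ι, a p.1.1 * b p.1.2 * c p.2 := by
  rw [tsum_mul_tsum_of_summable_norm ha.norm hb.norm]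
  exact tsum_mul_tsum_of_summable_norm (f := fun p : ι × ι => a p.1 * b p.2)
    (summable_mul_of_summable_norm ha.norm hb.norm).norm hc.norm

/-- **Lemma 8.2 of Heim–Murase, first formula.** If `F` has Fourier coefficients `A(n,r,m)`
supported on `n > 0`, `4nm > r²`, and `F↑(τ,z,τ') = F(2τ,2z,τ')·F(τ/2,z,τ')·F((τ+1)/2,z,τ')`
has Fourier coefficients `B`, then
`B(4,r,3) = Σ_{2r₁+r₂+r₃=r} A(1,r₁,1)·(A(2,r₂,1)A(2,r₃,1) − A(3,r₂,1)A(1,r₃,1) − A(1,r₂,1)A(3,r₃,1))`. -/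
theorem fourier_coeff_up
    (A : ℤ × ℤ × ℤ → ℂ)
    (hsupp : ∀ q : ℤ × ℤ × ℤ, ¬ (0 < q.1 ∧ q.2.1 ^ 2 < 4 * q.1 * q.2.2) → A q = 0)
    (hAconv : ∀ t ∈ H2, Summable (fun q : ℤ × ℤ × ℤ =>
      A q * e ((q.1 : ℂ) * t.1 + (q.2.1 : ℂ) * t.2.1 + (q.2.2 : ℂ) * t.2.2)))
    (B : ℤ × ℤ × ℤ → ℂ)
    (hBconv : ∀ t ∈ H2, Summable (fun q : ℤ × ℤ × ℤ =>
      B q * e ((q.1 : ℂ) * t.1 + (q.2.1 : ℂ) * t.2.1 + (q.2.2 : ℂ) * t.2.2)))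
    (hB : ∀ t ∈ H2,
      FS A (2 * t.1) (2 * t.2.1) t.2.2 * FS A (t.1 / 2) t.2.1 t.2.2 *
          FS A ((t.1 + 1) / 2) t.2.1 t.2.2
        = ∑' q : ℤ × ℤ × ℤ,
            B q * e ((q.1 : ℂ) * t.1 + (q.2.1 : ℂ) * t.2.1 + (q.2.2 : ℂ) * t.2.2))
    (r : ℤ) :
    B (4, r, 3)
      = ∑' u : {u : ℤ × ℤ × ℤ // 2 * u.1 + u.2.1 + u.2.2 = r},
          A (1, u.1.1, 1) *
            (A (2, u.1.2.1, 1) * A (2, u.1.2.2, 1) -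
             A (3, u.1.2.1, 1) * A (1, u.1.2.2, 1) -
             A (1, u.1.2.1, 1) * A (3, u.1.2.2, 1)) := by
  have hpos : ∀ q : ℤ × ℤ × ℤ, A q ≠ 0 → 0 < q.1 ∧ 0 < q.2.2 := by
    intro q hq
    obtain ⟨h₁, h₂⟩ := not_not.1 (mt (hsupp q) hq)
    refine ⟨h₁, ?_⟩
    have h₃ : 0 < 4 * q.1 * q.2.2 := (sq_nonneg _).trans_lt h₂
    exact (mul_pos_iff_of_pos_left (by omega)).1 h₃
  have mem : ∀ τ z τ' : ℂ, z.im = 0 → 0 < τ.im → 0 < τ'.im → (τ, z, τ') ∈ H2 := by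
    intro τ z τ' hz h₁ h₂
    refine ⟨h₁, h₂, ?_⟩
    simpa [hz] using mul_pos h₁ h₂
  let a₁ (q : ℤ × ℤ × ℤ) : ℂ := A q * e (q.1 * (2 * I) + q.2.1 * 0 + q.2.2 * I)
  let a₂ (q : ℤ × ℤ × ℤ) : ℂ := A q * e (q.1 * (I / 2) + q.2.1 * 0 + q.2.2 * I)
  let a₃ (q : ℤ × ℤ × ℤ) : ℂ := A q * e (q.1 * ((I + 1) / 2) + q.2.1 * 0 + q.2.2 * I)
  let b (q : ℤ × ℤ × ℤ) : ℂ := B q * e (q.1 * I + q.2.1 * 0 + q.2.2 * I)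
  let a (p : ((ℤ × ℤ × ℤ) × (ℤ × ℤ × ℤ)) × (ℤ × ℤ × ℤ)) : ℂ := a₁ p.1.1 * a₂ p.1.2 * a₃ p.2
  let f (p : ((ℤ × ℤ × ℤ) × (ℤ × ℤ × ℤ)) × (ℤ × ℤ × ℤ)) : ℤ × ℤ × ℤ :=
    (4 * p.1.1.1 + p.1.2.1 + p.2.1, 2 * p.1.1.2.1 + p.1.2.2.1 + p.2.2.1,
      p.1.1.2.2 + p.1.2.2.2 + p.2.2.2)
  have ha : Summable a := by
    have h₁ : Summable a₁ := hAconv (2 * I, 0, I) (mem _ _ _ (by simp) (by simp) (by simp))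
    have h₂ : Summable a₂ := hAconv (I / 2, 0, I) (mem _ _ _ (by simp) (by simp) (by simp))
    have h₃ : Summable a₃ :=
      hAconv ((I + 1) / 2, 0, I) (mem _ _ _ (by simp) (by simp) (by simp))
    exact summable_mul_mul h₁ h₂ h₃
  have hb : Summable b := hBconv (I, 0, I) (mem _ _ _ (by simp) (by simp) (by simp))
  have hab := tsum_fiber_congr₃ ha hb f (fun q => (2 * q.1, q.2)) (fun x y z => by
    have hAz : ∀ τ z τ' : ℂ, z.im = 0 → 0 < τ.im → 0 < τ'.im → Summable fun q : ℤ × ℤ × ℤ =>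
        A q * e ((q.1 : ℂ) * τ + (q.2.1 : ℂ) * z + (q.2.2 : ℂ) * τ') := fun τ z τ' h₀ h₁ h₂ =>
      hAconv (τ, z, τ') (mem τ z τ' h₀ h₁ h₂)
    have h := hB (2 * x + I, y, z + I) (mem _ _ _ (by simp) (by simp) (by simp))
    have h₁ := hAz (2 * (2 * x + I)) (2 * y) (z + I) (by simp) (by simp) (by simp)
    have h₂ := hAz ((2 * x + I) / 2) y (z + I) (by simp) (by simp) (by simp)
    have h₃ := hAz ((2 * x + I + 1) / 2) y (z + I) (by simp) (by simp) (by simp)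
    simp only [FS] at h
    rw [tsum_mul_tsum_mul_tsum h₁ h₂ h₃] at h
    convert h using 3 with p q
    · simp only [a, a₁, a₂, a₃, f]
      have (A₁ A₂ A₃ u₁ u₂ u₃ v : ℂ) : A₁ * e u₁ * (A₂ * e u₂) * (A₃ * e u₃) * e v
          = A₁ * A₂ * A₃ * e (u₁ + u₂ + u₃ + v) := by
        simp only [e_add]
        ring
      have h' (A₁ A₂ A₃ u₁ u₂ u₃ : ℂ) : A₁ * e u₁ * (A₂ * e u₂) * (A₃ * e u₃)
          = A₁ * A₂ * A₃ * e (u₁ + u₂ + u₃) := by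
        simp only [e_add]
        ring
      rw [this, h']
      congr 2
      push_cast
      ring
    · simp only [b]
      rw [mul_assoc, ← e_add]
      congr 2
      push_cast
      ring) (8, r, 3)
  have hbr : ∑' q : ℤ × ℤ × ℤ, (if (2 * q.1, q.2) = ((8 : ℤ), r, (3 : ℤ)) then b q else 0)
      = B (4, r, 3) * e (7 * I) := by
    rw [tsum_eq_single (4, r, 3)]
    · simp only [b]
      norm_num
      left
      congr 1
      ring
    · rintro ⟨n, s, m⟩ hq
      refine if_neg fun h => hq ?_
      simp only [Prod.mk.injEq] at h ⊢
      omega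
  let φ (p : {u : ℤ × ℤ × ℤ // 2 * u.1 + u.2.1 + u.2.2 = r} × Fin 3) :
      ((ℤ × ℤ × ℤ) × (ℤ × ℤ × ℤ)) × (ℤ × ℤ × ℤ) :=
    (((1, p.1.1.1, 1), (![2, 3, 1] p.2, p.1.1.2.1, 1)), (![2, 1, 3] p.2, p.1.1.2.2, 1))
  have hφ : Function.Injective φ := by
    rintro ⟨⟨⟨u₁, u₂, u₃⟩, hu⟩, j⟩ ⟨⟨⟨v₁, v₂, v₃⟩, hv⟩, k⟩ h
    simp only [φ, Prod.mk.injEq] at h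
    obtain ⟨⟨⟨-, rfl, -⟩, h₁, rfl, -⟩, -, rfl, -⟩ := h
    have : j = k := by
      fin_cases j <;> fin_cases k <;> simp at h₁ ⊢
    rw [this]
  have hrange : (Function.support fun p => if f p = (8, r, 3) then a p else 0) ⊆ Set.range φ := by
    rintro ⟨⟨⟨n₁, r₁, m₁⟩, ⟨n₂, r₂, m₂⟩⟩, ⟨n₃, r₃, m₃⟩⟩ hp
    simp only [Function.mem_support, ne_eq, ite_eq_right_iff, Classical.not_imp, f, a, a₁, a₂, a₃,
      Prod.mk.injEq, mul_eq_zero, not_or] at hp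
    obtain ⟨⟨hn, hr, hm⟩, ⟨⟨h₁, -⟩, ⟨h₂, -⟩⟩, ⟨h₃, -⟩⟩ := hp
    have h₁' := hpos _ h₁
    have h₂' := hpos _ h₂
    have h₃' := hpos _ h₃
    simp only at h₁' h₂' h₃'
    obtain rfl : n₁ = 1 := by omega
    obtain rfl : m₁ = 1 := by omega
    obtain rfl : m₂ = 1 := by omega
    obtain rfl : m₃ = 1 := by omega
    have hcases : (n₂ = 2 ∧ n₃ = 2) ∨ (n₂ = 3 ∧ n₃ = 1) ∨ (n₂ = 1 ∧ n₃ = 3) := by omega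
    rcases hcases with ⟨rfl, rfl⟩ | ⟨rfl, rfl⟩ | ⟨rfl, rfl⟩
    · exact ⟨(⟨(r₁, r₂, r₃), hr⟩, 0), rfl⟩
    · exact ⟨(⟨(r₁, r₂, r₃), hr⟩, 1), rfl⟩
    · exact ⟨(⟨(r₁, r₂, r₃), hr⟩, 2), rfl⟩
  have hterm : ∀ p, f p = (8, r, 3) →
      a p = A p.1.1 * A p.1.2 * A p.2 * e (p.2.1 / 2) * e (7 * I) := by
    intro p hp
    simp only [f, Prod.mk.injEq] at hp
    obtain ⟨hn, -, hm⟩ := hp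
    have hn' : (4 * p.1.1.1 + p.1.2.1 + p.2.1 : ℂ) = 8 := by exact_mod_cast hn
    have hm' : (p.1.1.2.2 + p.1.2.2.2 + p.2.2.2 : ℂ) = 3 := by exact_mod_cast hm
    have hexp : (p.2.1 / 2 + 7 * I : ℂ) = p.1.1.1 * (2 * I) + p.1.1.2.1 * 0 + p.1.1.2.2 * I
        + (p.1.2.1 * (I / 2) + p.1.2.2.1 * 0 + p.1.2.2.2 * I)
        + (p.2.1 * ((I + 1) / 2) + p.2.2.1 * 0 + p.2.2.2 * I) := by
      linear_combination (-I / 2) * hn' - I * hm'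
    rw [mul_assoc _ (e _) (e _), ← e_add, hexp, e_add, e_add]
    simp only [a, a₁, a₂, a₃]
    ring
  have hfφ : ∀ p, f (φ p) = (8, r, 3) := by
    rintro ⟨⟨u, hu⟩, j⟩
    simp only [f, φ, Prod.mk.injEq]
    refine ⟨?_, hu, by norm_num⟩
    fin_cases j <;> simp
  have hsum : Summable fun p => a (φ p) := ha.comp_injective hφ
  rw [hbr, ← hφ.tsum_eq hrange] at hab
  simp only [hfφ, if_true] at hab
  rw [hsum.tsum_prod] at hab
  refine mul_right_cancel₀ (e_ne_zero (7 * I)) ?_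
  rw [← hab, ← tsum_mul_right]
  refine tsum_congr fun u => ?_
  have he : e 1 = 1 := by simpa using e_int 1
  simp only [fun p => hterm (φ p) (hfφ p), tsum_fintype, Fin.sum_univ_three]
  simp [φ, e_one_half, e_three_halves, he, -one_div]
  ring

end HeimMurase
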